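/- Let G be an invertible n×n real matrix whose rows g₁,…,gₙ satisfy G·Gᵀ = Jₙ + Iₙ (the Aₙ basis). For every subset S ⊆ {2,…,n}, writing x_S = Σ_{j∈S} g_j ∈ C⁰, the set of corners of C⁰ sharing an (n−1)-dimensional Voronoi facet with x_S + g₁ ∈ C¹ is exactly T_f(x_S + g₁) ∩ C⁰ = {x_S} ∪ {x_S + g_k : k ∈ {2,…,n} \ S}. In particular |T_f(x_S + g₁) ∩ C⁰| = 1 + (n − 1 − |S|). -/

import Mathlib

open Matrix Finset

/-- Euclidean norm of a vector in `ℝⁿ`. -/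
noncomputable def nrm {n : ℕ} (v : Fin n → ℝ) : ℝ := Real.sqrt (∑ i, v i ^ 2)

/-- The lattice generated by the rows of `G`. -/
def latticePt {n : ℕ} (G : Matrix (Fin n) (Fin n) ℝ) (x : Fin n → ℝ) : Prop :=
  ∃ z : Fin n → ℤ, x = (fun i => (z i : ℝ)) ᵥ* G

/-- The Voronoi region of `x` in the lattice generated by `G`. -/
def Vor {n : ℕ} (G : Matrix (Fin n) (Fin n) ℝ) (x : Fin n → ℝ) : Set (Fin n → ℝ) :=
  {y | ∀ lam : Fin n → ℝ, latticePt G lam → nrm (y - x) ≤ nrm (y - lam)}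

/-- `x'` shares an `(n−1)`-dimensional Voronoi facet with `x`. -/
def sharesFacet {n : ℕ} (G : Matrix (Fin n) (Fin n) ℝ) (x x' : Fin n → ℝ) : Prop :=
  Module.finrank ℝ (affineSpan ℝ (Vor G x ∩ Vor G x')).direction = n - 1

/-- The corner set `C^b = {zG : z ∈ {0,1}ⁿ, z₁ = b}`. -/
def cornerSet {n : ℕ} [NeZero n] (G : Matrix (Fin n) (Fin n) ℝ) (b : ℝ) :
    Set (Fin n → ℝ) :=
  {x | ∃ z : Fin n → ℝ, (∀ i, z i = 0 ∨ z i = 1) ∧ z 0 = b ∧ x = z ᵥ* G}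

/-- A real vector all of whose coordinates are integers. -/
def IntCoords {n : ℕ} (z : Fin n → ℝ) : Prop := ∀ i, ∃ m : ℤ, z i = m

/-- The bilinear form on coordinate vectors with matrix `Jₙ + Iₙ`. -/
def gramForm {n : ℕ} (a b : Fin n → ℝ) : ℝ := (∑ i, a i) * (∑ i, b i) + a ⬝ᵥ b

namespace IntCoords

variable {n : ℕ} {a b : Fin n → ℝ}

lemma add (ha : IntCoords a) (hb : IntCoords b) : IntCoords (a + b) := fun i => by
  obtain ⟨k, hk⟩ := ha i
  obtain ⟨l, hl⟩ := hb i
  exact ⟨k + l, by simp [hk, hl]⟩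

lemma neg (ha : IntCoords a) : IntCoords (-a) := fun i => by
  obtain ⟨k, hk⟩ := ha i
  exact ⟨-k, by simp [hk]⟩

lemma sub (ha : IntCoords a) (hb : IntCoords b) : IntCoords (a - b) :=
  sub_eq_add_neg a b ▸ ha.add hb.neg

lemma single (i : Fin n) : IntCoords (Pi.single i (1 : ℝ)) := fun j => by
  by_cases h : j = i
  · subst h; exact ⟨1, by simp⟩
  · exact ⟨0, by simp [h]⟩

lemma of_zero_or_one (h : ∀ i, a i = 0 ∨ a i = 1) : IntCoords a := fun i => by
  rcases h i with h | h
  · exact ⟨0, by simp [h]⟩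
  · exact ⟨1, by simp [h]⟩

lemma exists_sum_eq (ha : IntCoords a) : ∃ m : ℤ, ∑ i, a i = m := by
  choose f hf using ha
  exact ⟨∑ i, f i, by simp [hf]⟩

end IntCoords

lemma latticePt_iff {n : ℕ} {G : Matrix (Fin n) (Fin n) ℝ} {x : Fin n → ℝ} :
    latticePt G x ↔ ∃ z, IntCoords z ∧ x = z ᵥ* G := by
  constructor
  · rintro ⟨z, rfl⟩
    exact ⟨_, fun i => ⟨z i, rfl⟩, rfl⟩
  · rintro ⟨z, hz, rfl⟩
    choose f hf using hz
    exact ⟨f, by rw [← funext hf]⟩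

lemma nrm_le_nrm_iff {n : ℕ} {v w : Fin n → ℝ} : nrm v ≤ nrm w ↔ v ⬝ᵥ v ≤ w ⬝ᵥ w := by
  unfold nrm
  rw [Real.sqrt_le_sqrt_iff (Finset.sum_nonneg fun i _ => sq_nonneg _)]
  simp [dotProduct, pow_two]

section gramForm

variable {n : ℕ} (a b c : Fin n → ℝ)

lemma gramForm_comm : gramForm a b = gramForm b a := by
  simp only [gramForm, dotProduct_comm a b]; ring

lemma gramForm_add_left : gramForm (a + b) c = gramForm a c + gramForm b c := by
  simp only [gramForm, add_dotProduct, Pi.add_apply, Finset.sum_add_distrib]; ring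

lemma gramForm_neg_left : gramForm (-a) b = -gramForm a b := by
  simp only [gramForm, neg_dotProduct, Pi.neg_apply, Finset.sum_neg_distrib]; ring

lemma gramForm_single_left (i : Fin n) : gramForm (Pi.single i 1) a = (∑ j, a j) + a i := by
  simp [gramForm]

end gramForm

section Voronoi

variable {n : ℕ} {G : Matrix (Fin n) (Fin n) ℝ} {x c : Fin n → ℝ}

lemma dotProduct_mulVec_vecMul
    (hGram : G * G.transpose = Matrix.of (fun _ _ => (1 : ℝ)) + 1) (a b : Fin n → ℝ) :
    a ⬝ᵥ (G *ᵥ (b ᵥ* G)) = gramForm a b := by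
  rw [← mulVec_transpose, mulVec_mulVec, hGram, add_mulVec, one_mulVec, dotProduct_add]
  simp [gramForm, dotProduct, mulVec, Finset.sum_mul]

lemma mem_Vor_iff (hGram : G * G.transpose = Matrix.of (fun _ _ => (1 : ℝ)) + 1)
    (hx : latticePt G x) (y : Fin n → ℝ) :
    y ∈ Vor G x ↔ ∀ z, IntCoords z → 2 * (z ⬝ᵥ (G *ᵥ (y - x))) ≤ gramForm z z := by
  obtain ⟨a, ha, rfl⟩ := latticePt_iff.1 hx
  have key : ∀ z, (nrm (y - a ᵥ* G) ≤ nrm (y - (a + z) ᵥ* G)) ↔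
      2 * (z ⬝ᵥ (G *ᵥ (y - a ᵥ* G))) ≤ gramForm z z := by
    intro z
    rw [nrm_le_nrm_iff, add_vecMul, ← sub_sub, ← dotProduct_mulVec_vecMul hGram]
    generalize y - a ᵥ* G = t
    rw [dotProduct_mulVec, dotProduct_mulVec, sub_dotProduct, dotProduct_sub, dotProduct_sub,
      dotProduct_comm t (z ᵥ* G)]
    constructor <;> intro h <;> linarith
  constructor
  · intro h z hz
    exact (key z).1 (h _ (latticePt_iff.2 ⟨_, ha.add hz, rfl⟩))
  · intro h lam hlam
    obtain ⟨b, hb, rfl⟩ := latticePt_iff.1 hlam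
    have := (key (b - a)).2 (h _ (hb.sub ha))
    rwa [add_sub_cancel] at this

lemma mem_Vor_inter_iff (hGram : G * G.transpose = Matrix.of (fun _ _ => (1 : ℝ)) + 1)
    (hx : latticePt G x) (hc : IntCoords c) (y : Fin n → ℝ) :
    y ∈ Vor G x ∩ Vor G (x + c ᵥ* G) ↔
      y ∈ Vor G x ∧ 2 * (c ⬝ᵥ (G *ᵥ (y - x))) = gramForm c c := by
  have hx' : latticePt G (x + c ᵥ* G) := by
    obtain ⟨a, ha, rfl⟩ := latticePt_iff.1 hx
    exact latticePt_iff.2 ⟨_, ha.add hc, by rw [add_vecMul]⟩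
  have hz' : ∀ z, z ⬝ᵥ (G *ᵥ (y - (x + c ᵥ* G))) = z ⬝ᵥ (G *ᵥ (y - x)) - gramForm z c := by
    intro z
    rw [← sub_sub, mulVec_sub, dotProduct_sub, dotProduct_mulVec_vecMul hGram]
  rw [Set.mem_inter_iff]
  refine and_congr_right fun hy => ?_
  rw [mem_Vor_iff hGram hx] at hy
  rw [mem_Vor_iff hGram hx']
  constructor
  · intro h
    have h1 := hy c hc
    have h2 := h (-c) hc.neg
    rw [hz', neg_dotProduct, gramForm_neg_left, gramForm_neg_left, gramForm_comm c (-c),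
      gramForm_neg_left] at h2
    linarith
  · intro h z hz
    have h1 := hy (z + c) (hz.add hc)
    rw [add_dotProduct, gramForm_add_left, gramForm_comm z, gramForm_comm c,
      gramForm_add_left, gramForm_add_left, gramForm_comm c z] at h1
    rw [hz']
    linarith

/-- The functional pairing a vector with the lattice vector of coordinates `c`. -/
noncomputable def pairing (G : Matrix (Fin n) (Fin n) ℝ) (c : Fin n → ℝ) :
    (Fin n → ℝ) →ₗ[ℝ] ℝ :=
  dotProductBilin ℝ ℝ c ∘ₗ G.mulVecLin

@[simp] lemma pairing_apply (c w : Fin n → ℝ) : pairing G c w = c ⬝ᵥ (G *ᵥ w) := rfl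

lemma finrank_ker_pairing (hG : IsUnit G.det) (hc : c ≠ 0) :
    Module.finrank ℝ (LinearMap.ker (pairing G c)) = n - 1 := by
  have hne : pairing G c ≠ 0 := by
    intro h
    apply hc
    have h1 := LinearMap.congr_fun h (G⁻¹ *ᵥ c)
    simpa [mulVec_mulVec, Matrix.mul_nonsing_inv _ hG] using h1
  have h1 := (pairing G c).finrank_range_add_finrank_ker
  rw [LinearMap.range_eq_top.2 (LinearMap.surjective hne)] at h1
  simp at h1
  omega

lemma direction_le_ker_pairing {s : Set (Fin n → ℝ)} {r : ℝ}
    (h : ∀ y ∈ s, c ⬝ᵥ (G *ᵥ (y - x)) = r) :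
    (affineSpan ℝ s).direction ≤ LinearMap.ker (pairing G c) := by
  rw [direction_affineSpan, vectorSpan_def, Submodule.span_le]
  rintro _ ⟨y, hy, y', hy', rfl⟩
  have h1 := h y hy
  have h2 := h y' hy'
  simp only [mulVec_sub, dotProduct_sub] at h1 h2
  simp only [vsub_eq_sub, SetLike.mem_coe, LinearMap.mem_ker, pairing_apply, mulVec_sub,
    dotProduct_sub]
  linarith

/-- If a lattice vector `c` splits as `u + (c - u)` at a non-obtuse angle, with `u` not parallel
to `c`, then `c` is not a facet vector. -/
lemma not_sharesFacet_of_split (hG : IsUnit G.det)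
    (hGram : G * G.transpose = Matrix.of (fun _ _ => (1 : ℝ)) + 1)
    (hx : latticePt G x) (hc : IntCoords c) {u p : Fin n → ℝ} (hu : IntCoords u)
    (huc : gramForm u u ≤ gramForm u c) (hcp : c ⬝ᵥ p = 0) (hup : u ⬝ᵥ p ≠ 0) (hc0 : c ≠ 0) :
    ¬ sharesFacet G x (x + c ᵥ* G) := by
  intro h
  have hdc : (affineSpan ℝ (Vor G x ∩ Vor G (x + c ᵥ* G))).direction ≤
      LinearMap.ker (pairing G c) :=
    direction_le_ker_pairing (x := x) (r := gramForm c c / 2) fun y hy => by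
      rw [mem_Vor_inter_iff hGram hx hc] at hy
      linarith [hy.2]
  have hdu : (affineSpan ℝ (Vor G x ∩ Vor G (x + c ᵥ* G))).direction ≤
      LinearMap.ker (pairing G u) :=
    direction_le_ker_pairing (x := x) (r := gramForm u u / 2) fun y hy => by
      rw [mem_Vor_inter_iff hGram hx hc, mem_Vor_iff hGram hx] at hy
      have h1 := hy.1 u hu
      have h2 := hy.1 (c + -u) (hc.add hu.neg)
      rw [add_dotProduct, neg_dotProduct, gramForm_add_left, gramForm_comm c, gramForm_comm (-u),
        gramForm_add_left, gramForm_add_left, gramForm_neg_left, gramForm_comm c (-u),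
        gramForm_neg_left, gramForm_neg_left, gramForm_comm u (-u), gramForm_neg_left] at h2
      linarith [hy.2]
  have hmem : G *ᵥ (G⁻¹ *ᵥ p) = p := by
    rw [mulVec_mulVec, Matrix.mul_nonsing_inv _ hG, one_mulVec]
  have heq := Submodule.eq_of_le_of_finrank_eq hdc (h.trans (finrank_ker_pairing hG hc0).symm)
  have : G⁻¹ *ᵥ p ∈ LinearMap.ker (pairing G c) := by simp [hmem, hcp]
  rw [← heq] at this
  have := hdu this
  simp only [LinearMap.mem_ker, pairing_apply, hmem] at this
  exact hup this

lemma mul_le_sq_of_int {a d : ℝ} (ha : ∃ m : ℤ, a = m) (hd : |d| ≤ 1) : a * d ≤ a ^ 2 := by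
  obtain ⟨m, rfl⟩ := ha
  have h1 : |(m : ℝ)| ≤ (m : ℝ) ^ 2 := by
    rw [← sq_abs]
    exact_mod_cast Int.le_self_sq |m|
  calc (m : ℝ) * d ≤ |(m : ℝ) * d| := le_abs_self _
    _ = |(m : ℝ)| * |d| := abs_mul _ _
    _ ≤ |(m : ℝ)| * 1 := by gcongr
    _ ≤ _ := by linarith

lemma dotProduct_le_gramForm {z p : Fin n → ℝ} (hz : IntCoords z) {t : ℝ} (ht : |t| ≤ 1)
    (hp : ∀ i, |2 * p i - t| ≤ 1) : 2 * (z ⬝ᵥ p) ≤ gramForm z z := by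
  have h1 := mul_le_sq_of_int hz.exists_sum_eq ht
  have h2 : ∑ i, z i * (2 * p i - t) ≤ ∑ i, z i ^ 2 :=
    Finset.sum_le_sum fun i _ => mul_le_sq_of_int (hz i) (hp i)
  have h3 : ∑ i, z i * (2 * p i - t) = 2 * (z ⬝ᵥ p) - (∑ i, z i) * t := by
    rw [dotProduct, Finset.mul_sum, Finset.sum_mul, ← Finset.sum_sub_distrib]
    exact Finset.sum_congr rfl fun i _ => by ring
  have h4 : gramForm z z = (∑ i, z i) ^ 2 + ∑ i, z i ^ 2 := by
    simp [gramForm, dotProduct, pow_two]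
  linarith

/-- A criterion for `c` to be a facet vector; in the ambient coordinates of `Aₙ` it says that
the coordinates of `c` lie in `{-1, 0, 1}` and that any vector orthogonal to `c` is constant on
the support of `c`. -/
lemma sharesFacet_of_root (hG : IsUnit G.det)
    (hGram : G * G.transpose = Matrix.of (fun _ _ => (1 : ℝ)) + 1)
    (hx : latticePt G x) (hc : IntCoords c) (hc0 : c ≠ 0) (hci : ∀ i, |c i| ≤ 1)
    (hcs : |∑ i, c i| ≤ 1)
    (hq : ∀ q, c ⬝ᵥ q = 0 → ∃ t, (∀ i, c i ≠ 0 → q i = t) ∧ (∑ i, c i ≠ 0 → t = 0)) :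
    sharesFacet G x (x + c ᵥ* G) := by
  have hdc : (affineSpan ℝ (Vor G x ∩ Vor G (x + c ᵥ* G))).direction ≤
      LinearMap.ker (pairing G c) :=
    direction_le_ker_pairing (x := x) (r := gramForm c c / 2) fun y hy => by
      rw [mem_Vor_inter_iff hGram hx hc] at hy
      linarith [hy.2]
  unfold sharesFacet
  rw [le_antisymm hdc fun w hw => ?_, finrank_ker_pairing hG hc0]
  replace hw : c ⬝ᵥ (G *ᵥ w) = 0 := hw
  obtain ⟨t, hct, hst⟩ := hq _ hw
  obtain ⟨j, hj⟩ := Function.ne_iff.1 hc0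
  have hjt := hct j hj
  set q := G *ᵥ w
  obtain ⟨e, he0, he⟩ : ∃ e > 0, ∀ i, 4 * e * |q i| ≤ 1 := by
    have hB : 0 < 1 + ∑ i, |q i| := by positivity
    refine ⟨1 / (4 * (1 + ∑ i, |q i|)), by positivity, fun i => ?_⟩
    have := Finset.single_le_sum (f := fun i => |q i|) (fun i _ => abs_nonneg _)
      (Finset.mem_univ i)
    field_simp
    linarith
  have hmem : ∀ s, 0 ≤ s → s ≤ e →
      x + (1 / 2 : ℝ) • (c ᵥ* G) + s • w ∈ Vor G x ∩ Vor G (x + c ᵥ* G) := by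
    intro s hs0 hse
    have hs : ∀ i, |s * q i| ≤ 1 / 4 := fun i => by
      rw [abs_mul, abs_of_nonneg hs0]
      have := mul_le_mul_of_nonneg_right hse (abs_nonneg (q i))
      linarith [he i]
    have hdot : ∀ z, z ⬝ᵥ (G *ᵥ (x + (1 / 2 : ℝ) • (c ᵥ* G) + s • w - x)) =
        z ⬝ᵥ ((1 / 2 : ℝ) • (c + fun _ => ∑ i, c i) + s • q) := by
      intro z
      rw [add_assoc, add_sub_cancel_left, mulVec_add, mulVec_smul, mulVec_smul, dotProduct_add,
        dotProduct_add, dotProduct_smul, dotProduct_mulVec_vecMul hGram, dotProduct_smul,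
        dotProduct_smul, dotProduct_add]
      simp only [gramForm, dotProduct, Finset.sum_mul, smul_eq_mul]
      ring
    rw [mem_Vor_inter_iff hGram hx hc, mem_Vor_iff hGram hx]
    constructor
    · intro z hz
      rw [hdot]
      apply dotProduct_le_gramForm hz (t := ∑ i, c i + 2 * (s * t))
      · by_cases h : ∑ i, c i = 0
        · have := hs j
          rw [hjt, abs_le] at this
          rw [h, abs_le]
          constructor <;> linarith
        · simpa [hst h] using hcs
      · intro i
        have : 2 * ((1 / 2 : ℝ) • (c + fun _ => ∑ i, c i) + s • q : Fin n → ℝ) i -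
            (∑ i, c i + 2 * (s * t)) = c i + 2 * (s * q i) - 2 * (s * t) := by
          simp only [Pi.add_apply, Pi.smul_apply, smul_eq_mul]; ring
        rw [this]
        by_cases h : c i = 0
        · have h1 := abs_le.1 (hs i)
          have h2 := abs_le.1 (hs j)
          rw [hjt] at h2
          rw [h, abs_le]
          constructor <;> linarith
        · simpa [hct i h] using hci i
    · rw [hdot, dotProduct_add, dotProduct_smul, dotProduct_smul, hw, dotProduct_add]
      simp only [gramForm, dotProduct, Finset.sum_mul, smul_eq_mul]
      ring
  have h1 := AffineSubspace.vsub_mem_direction (mem_affineSpan ℝ (hmem e he0.le le_rfl))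
    (mem_affineSpan ℝ (hmem 0 le_rfl he0.le))
  rw [vsub_eq_sub, zero_smul, add_zero, add_sub_cancel_left] at h1
  exact (Submodule.smul_mem_iff _ he0.ne').1 h1

end Voronoi

/-- for the `Aₙ` basis (Gram matrix `Jₙ + Iₙ`) and `S ⊆ {2,…,n}` (0-based:
`S` avoids index `0`), the facet-neighbors in `C⁰` of `x_S + g₁ ∈ C¹` are exactly `x_S`
and the points `x_S + g_k` for `k ∈ {2,…,n} \ S`; in particular there are
`1 + (n − 1 − |S|)` of them. -/
theorem An_neighbor_sets (n : ℕ) [NeZero n]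
    (G : Matrix (Fin n) (Fin n) ℝ) (hG : IsUnit G.det)
    (hGram : G * G.transpose = Matrix.of (fun _ _ => (1 : ℝ)) + 1)
    (S : Finset (Fin n)) (hS : (0 : Fin n) ∉ S) :
    let xS : Fin n → ℝ := ∑ j ∈ S, G j
    {x' : Fin n → ℝ | x' ∈ cornerSet G 0 ∧ sharesFacet G (xS + G 0) x'}
      = insert xS {x' : Fin n → ℝ | ∃ k : Fin n, k ≠ 0 ∧ k ∉ S ∧ x' = xS + G k} ∧
    Set.ncard {x' : Fin n → ℝ | x' ∈ cornerSet G 0 ∧ sharesFacet G (xS + G 0) x'}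
      = 1 + (n - 1 - S.card) := by
  intro xS
  set a : Fin n → ℝ := fun i => if i ∈ S then 1 else 0
  have ha01 : ∀ i, a i = 0 ∨ a i = 1 := fun i => by
    by_cases h : i ∈ S <;> simp [a, h]
  have ha : IntCoords a := .of_zero_or_one ha01
  have ha0 : a 0 = 0 := by simp [a, hS]
  have hxS : xS = a ᵥ* G := by
    ext i
    simpa [xS, a, vecMul, dotProduct] using Finset.sum_apply i S G
  have hrow : ∀ k, G k = Pi.single k 1 ᵥ* G := fun k => by simp [row]
  have hx : latticePt G (xS + G 0) :=
    latticePt_iff.2 ⟨_, ha.add (.single 0), by rw [add_vecMul, ← hxS, ← hrow]⟩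
  have hset : {x' : Fin n → ℝ | x' ∈ cornerSet G 0 ∧ sharesFacet G (xS + G 0) x'}
      = insert xS {x' : Fin n → ℝ | ∃ k : Fin n, k ≠ 0 ∧ k ∉ S ∧ x' = xS + G k} := by
    ext x'
    simp only [Set.mem_ofPred_eq, Set.mem_insert_iff]
    constructor
    · rintro ⟨⟨z, hz, hz0, rfl⟩, hf⟩
      have hza : z ᵥ* G = xS + G 0 + (z - a - Pi.single 0 1) ᵥ* G := by
        rw [sub_vecMul, sub_vecMul, ← hxS, ← hrow]; abel
      have hci : ∀ i ≠ 0, (z - a - Pi.single 0 1 : Fin n → ℝ) i = z i - a i := fun i hi => by simp [hi]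
      have hc : IntCoords (z - a - Pi.single 0 1) :=
        ((IntCoords.of_zero_or_one hz).sub ha).sub (.single 0)
      have hc0 : (z - a - Pi.single 0 1 : Fin n → ℝ) 0 = -1 := by simp [hz0, ha0]
      rw [hza] at hf
      generalize hcdef : z - a - Pi.single 0 1 = c at *
      have hnot : ∀ u j, IntCoords u → gramForm u u ≤ gramForm u c → c j ≠ 0 → u 0 ≠ 0 →
          u j = 0 → False := by
        intro u j hu huc hj hu0 huj
        refine not_sharesFacet_of_split hG hGram hx hc
          (p := Pi.single j 1 + c j • Pi.single 0 1) hu huc ?_ ?_ ?_ hf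
        · simp [hc0]
        · simp [huj, hj, hu0]
        · rintro rfl; simp at hj
      by_cases hpos : ∃ i ≠ 0, c i = 1
      · obtain ⟨i, hi0, hi⟩ := hpos
        have hother : ∀ j ≠ 0, j ≠ i → c j = 0 := by
          intro j hj0 hji
          by_contra hj
          refine hnot (Pi.single i 1 + -Pi.single 0 1) j
            ((IntCoords.single i).add (IntCoords.single 0).neg) ?_ hj ?_ ?_
          · simp only [gramForm_add_left, gramForm_neg_left, gramForm_single_left]
            simp [hi, hi0, hi0.symm, hc0]
            linarith
          · simp [hi0.symm]
          · simp [hj0, hji]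
        have hzi := hci i hi0
        have hiS : i ∉ S := by
          intro h
          rw [hi] at hzi
          simp only [a, h, if_true] at hzi
          rcases hz i with h | h <;> rw [h] at hzi <;> norm_num at hzi
        refine Or.inr ⟨i, hi0, hiS, ?_⟩
        rw [hxS, hrow i, ← add_vecMul]
        congr 1
        ext j
        by_cases hj0 : j = 0
        · subst hj0; simp [hz0, ha0, hi0.symm]
        · by_cases hji : j = i
          · subst hji; simp; linarith
          · have := hci j hj0
            rw [hother j hj0 hji] at this
            simp [hji]; linarith
      · push Not at hpos
        have hle : ∀ i ≠ 0, c i ≤ 0 := by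
          intro i hi
          have h1 := hpos i hi
          rw [hci i hi] at h1 ⊢
          rcases hz i with h | h <;> rcases ha01 i with h' | h' <;> rw [h, h'] at h1 ⊢ <;>
            revert h1 <;> norm_num
        have hzero : ∀ j ≠ 0, c j = 0 := by
          intro j hj0
          by_contra hj
          refine hnot (-Pi.single 0 1) j (IntCoords.single 0).neg ?_ hj ?_ ?_
          · have hsum : ∑ i, c i ≤ c 0 := by
              rw [← Finset.add_sum_erase _ _ (Finset.mem_univ (0 : Fin n))]
              have := Finset.sum_nonpos fun i (hi : i ∈ Finset.univ.erase (0 : Fin n)) =>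
                hle i (Finset.ne_of_mem_erase hi)
              linarith
            simp only [gramForm_neg_left, gramForm_single_left]
            simp [hc0]
            linarith
          · simp
          · simp [hj0]
        left
        rw [hxS]
        congr 1
        ext j
        by_cases hj0 : j = 0
        · subst hj0; rw [hz0, ha0]
        · have := hci j hj0
          rw [hzero j hj0] at this
          linarith
    · rintro (rfl | ⟨k, hk0, hkS, rfl⟩)
      · refine ⟨⟨a, ha01, ha0, hxS⟩, ?_⟩
        have := sharesFacet_of_root hG hGram hx (c := -Pi.single 0 1) (IntCoords.single 0).neg
          (by simp) (fun i => by by_cases h : i = 0 <;> simp [h]) (by simp)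
          (fun q hq => ⟨0, fun i hi => by
            have : i = 0 := by by_contra h; simp [h] at hi
            subst this; simpa using hq, fun _ => rfl⟩)
        rwa [neg_vecMul, ← hrow, add_neg_cancel_right] at this
      · refine ⟨⟨a + Pi.single k 1, fun i => ?_, by simp [ha0, hk0.symm], ?_⟩, ?_⟩
        · by_cases h : i = k
          · subst h; simp [a, hkS]
          · simpa [h] using ha01 i
        · rw [add_vecMul, ← hxS, ← hrow]
        · have := sharesFacet_of_root hG hGram hx (c := Pi.single k 1 - Pi.single 0 1)
            ((IntCoords.single k).sub (.single 0))
            (fun h => by simpa [hk0] using congrFun h k)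
            (fun i => by
              by_cases h : i = 0
              · subst h; simp [hk0.symm]
              · by_cases h' : i = k <;> simp [h, h', hk0])
            (by simp)
            (fun q hq => ⟨q 0, fun i hi => by
              by_cases h : i = 0
              · rw [h]
              · have : i = k := by by_contra h'; simp [h, h'] at hi
                subst this
                simpa [sub_dotProduct, sub_eq_zero] using hq, fun h => by simp at h⟩)
          rwa [sub_vecMul, ← hrow, ← hrow,
            show xS + G 0 + (G k - G 0) = xS + G k by abel] at this
  refine ⟨hset, ?_⟩
  have hdot : ∀ k l, G k ⬝ᵥ G l = 1 + if k = l then 1 else 0 := fun k l => by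
    have := congrFun (congrFun hGram k) l
    rwa [Matrix.add_apply, Matrix.one_apply, Matrix.of_apply] at this
  have hinj : Function.Injective fun k => xS + G k := by
    intro k l hkl
    by_contra hne
    have h1 : G k ⬝ᵥ G k = G k ⬝ᵥ G l := by rw [add_left_cancel hkl]
    simp [hdot, hne] at h1
  have himage : {x' : Fin n → ℝ | ∃ k : Fin n, k ≠ 0 ∧ k ∉ S ∧ x' = xS + G k} =
      Set.image (fun k => xS + G k) ((insert 0 S)ᶜ : Finset (Fin n)) := by
    ext x'
    simp [eq_comm (a := x'), and_assoc, and_left_comm]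
  rw [hset, himage, Set.ncard_insert_of_notMem _ (Set.toFinite _), Set.ncard_image_of_injective _ hinj,
    Set.ncard_coe_finset, Finset.card_compl, Finset.card_insert_of_notMem hS, Fintype.card_fin]
  · omega
  · rintro ⟨k, -, hk⟩
    have h0 : G k = 0 := by simpa using hk
    have := hdot k k
    norm_num [h0] at this
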